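/- arXiv:1502.02808 — 14 statements merged into one kernel-verified Lean document; each statement's English description precedes it below -/
import Mathlib

section
/- Let $G$ be a graph of order $n$ with minimum degree $\delta(G)\geq 3$. Then $\gamma_{st}(G)\leq n-2\lfloor(2\rho_{o}(G)+\delta-3)/2\rfloor$, where $\rho_{o}(G)$ is the open packing number of $G$. -/
open Finset

/-- A signed total dominating function of `G`. -/
def SimpleGraph.IsSTDF {V : Type*} [Fintype V] (G : SimpleGraph V) [DecidableRel G.Adj]
    (f : V → ℤ) : Prop :=
  (∀ v, f v = 1 ∨ f v = -1) ∧ ∀ v : V, 1 ≤ ∑ u ∈ G.neighborFinset v, f u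

/-- The signed total domination number of `G`. -/
noncomputable def SimpleGraph.signedTotalDominationNumber {V : Type*} [Fintype V]
    (G : SimpleGraph V) [DecidableRel G.Adj] : ℤ :=
  sInf {w : ℤ | ∃ f : V → ℤ, G.IsSTDF f ∧ w = ∑ v, f v}

/-- An open packing of `G`. -/
def SimpleGraph.IsOpenPacking {V : Type*} [Fintype V] [DecidableEq V] (G : SimpleGraph V)
    [DecidableRel G.Adj] (B : Finset V) : Prop :=
  ∀ u ∈ B, ∀ v ∈ B, u ≠ v → G.neighborFinset u ∩ G.neighborFinset v = ∅

/-- The open packing number of `G`. -/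
noncomputable def SimpleGraph.openPackingNumber {V : Type*} [Fintype V] [DecidableEq V]
    (G : SimpleGraph V) [DecidableRel G.Adj] : ℕ :=
  sSup {m : ℕ | ∃ B : Finset V, G.IsOpenPacking B ∧ B.card = m}

/-- A `k`-total limited packing of `G`. -/
def SimpleGraph.IsTotalLimitedPacking {V : Type*} [Fintype V] [DecidableEq V]
    (G : SimpleGraph V) [DecidableRel G.Adj] (k : ℕ) (L : Finset V) : Prop :=
  ∀ v : V, (G.neighborFinset v ∩ L).card ≤ k

/-- The `k`-total limited packing number of `G`. -/
noncomputable def SimpleGraph.totalLimitedPackingNumber {V : Type*} [Fintype V] [DecidableEq V]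
    (G : SimpleGraph V) [DecidableRel G.Adj] (k : ℕ) : ℕ :=
  sSup {m : ℕ | ∃ L : Finset V, G.IsTotalLimitedPacking k L ∧ L.card = m}

/-- A `k`-tuple total dominating set of `G`. -/
def SimpleGraph.IsTupleTotalDominatingSet {V : Type*} [Fintype V] [DecidableEq V]
    (G : SimpleGraph V) [DecidableRel G.Adj] (k : ℕ) (S : Finset V) : Prop :=
  ∀ v : V, k ≤ (G.neighborFinset v ∩ S).card

/-- The `k`-tuple total domination number of `G`. -/
noncomputable def SimpleGraph.tupleTotalDominationNumber {V : Type*} [Fintype V] [DecidableEq V]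
    (G : SimpleGraph V) [DecidableRel G.Adj] (k : ℕ) : ℕ :=
  sInf {m : ℕ | ∃ S : Finset V, G.IsTupleTotalDominatingSet k S ∧ S.card = m}

/-- The set of edges of `G` with one endpoint in `A` and the other in `B`. -/
def SimpleGraph.crossEdges {V : Type*} [Fintype V] [DecidableEq V] (G : SimpleGraph V)
    [DecidableRel G.Adj] (A B : Finset V) : Finset (Sym2 V) :=
  G.edgeFinset.filter (fun e => ∃ u ∈ A, ∃ w ∈ B, e = s(u, w))

/-- The set of edges of `G` with both endpoints in `A`. -/
def SimpleGraph.edgesWithin {V : Type*} [Fintype V] [DecidableEq V] (G : SimpleGraph V)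
    [DecidableRel G.Adj] (A : Finset V) : Finset (Sym2 V) :=
  G.edgeFinset.filter (fun e => ∀ v ∈ e, v ∈ A)


theorem stdf_sum_aux {V : Type*} [DecidableEq V] (L s : Finset V) :
    ∑ u ∈ s, (if u ∈ L then (-1 : ℤ) else 1) = (s.card : ℤ) - 2 * ((s ∩ L).card : ℤ) := by
  have h : ∀ u ∈ s, (if u ∈ L then (-1 : ℤ) else 1) = 1 - 2 * (if u ∈ L then 1 else 0) := by
    intro u _
    split_ifs <;> norm_num
  rw [Finset.sum_congr rfl h, Finset.sum_sub_distrib, ← Finset.mul_sum, Finset.sum_boole,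
    Finset.filter_mem_eq_inter]
  simp

/-- If `δ(G) ≥ 3`, then `γ_st(G) ≤ n - 2⌊(2ρ_o(G) + δ - 3)/2⌋`.
(Here `⌊(2ρ_o(G)+δ-3)/2⌋` is natural-number division.) -/
theorem signedTotalDominationNumber_le_of_openPacking {V : Type*} [Fintype V] [DecidableEq V]
    (G : SimpleGraph V) [DecidableRel G.Adj] (hδ : 3 ≤ G.minDegree) :
    G.signedTotalDominationNumber ≤
      (Fintype.card V : ℤ) -
        2 * (((2 * G.openPackingNumber + G.minDegree - 3) / 2 : ℕ) : ℤ) := by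
  have hmem : G.openPackingNumber ∈ {m : ℕ | ∃ B : Finset V, G.IsOpenPacking B ∧ B.card = m} := by
    apply Nat.sSup_mem
    · exact ⟨0, ∅, by intro u hu; simp at hu, by simp⟩
    · refine ⟨Fintype.card V, ?_⟩
      rintro m ⟨B, _, rfl⟩
      exact Finset.card_le_univ B
  obtain ⟨B, hB, hBc⟩ := hmem
  have hne : Nonempty V := by
    by_contra h
    rw [not_nonempty_iff] at h
    have : G.minDegree = 0 := by simp [SimpleGraph.minDegree]
    omega
  have h1 : ∀ v, (G.neighborFinset v ∩ B).card ≤ 1 := by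
    intro v
    rw [Finset.card_le_one]
    intro a ha b hb
    by_contra hab
    simp only [Finset.mem_inter, SimpleGraph.mem_neighborFinset] at ha hb
    have h := hB a ha.2 b hb.2 hab
    have : v ∈ G.neighborFinset a ∩ G.neighborFinset b := by
      simp [ha.1.symm, hb.1.symm]
    rw [h] at this
    simp at this
  have hd : ∀ v, G.minDegree ≤ (G.neighborFinset v).card := fun v => by
    rw [SimpleGraph.card_neighborFinset_eq_degree]; exact G.minDegree_le_degree v
  obtain ⟨v₀⟩ := hne
  have hc : (G.minDegree - 3) / 2 ≤ (Finset.univ \ B).card := by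
    have e := Finset.card_inter_add_card_sdiff (G.neighborFinset v₀) B
    have l : (G.neighborFinset v₀ \ B).card ≤ (Finset.univ \ B).card :=
      Finset.card_le_card (Finset.sdiff_subset_sdiff (Finset.subset_univ _) le_rfl)
    have := h1 v₀
    have := hd v₀
    omega
  obtain ⟨C, hC, hCc⟩ := Finset.exists_subset_card_eq hc
  have hdisj : Disjoint B C := (Finset.disjoint_of_subset_left hC Finset.sdiff_disjoint).symm
  have hL : (B ∪ C).card = G.openPackingNumber + (G.minDegree - 3) / 2 := by
    rw [Finset.card_union_of_disjoint hdisj, hBc, hCc]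
  apply csInf_le
  · refine ⟨-(Fintype.card V : ℤ), ?_⟩
    rintro w ⟨f, hf, rfl⟩
    have : ∑ v : V, (-1 : ℤ) ≤ ∑ v, f v :=
      Finset.sum_le_sum fun v _ => by rcases hf.1 v with h | h <;> rw [h]; norm_num
    simpa using this
  · refine ⟨fun u => if u ∈ B ∪ C then -1 else 1, ⟨?_, ?_⟩, ?_⟩
    · intro v
      by_cases h : v ∈ B ∪ C
      · right; exact if_pos h
      · left; exact if_neg h
    · intro v
      rw [stdf_sum_aux]
      have a := hd v
      have b := h1 v
      have c : (G.neighborFinset v ∩ C).card ≤ C.card :=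
        Finset.card_le_card Finset.inter_subset_right
      have d := Finset.card_union_le (G.neighborFinset v ∩ B) (G.neighborFinset v ∩ C)
      rw [← Finset.inter_union_distrib_left] at d
      omega
    · rw [stdf_sum_aux, Finset.univ_inter, hL, Finset.card_univ]
      omega
end

section
/- Let $G$ be a graph of order $n$ with minimum degree $\delta(G)\geq 3$. Then $\gamma_{st}(G)\leq n-2L_{\lfloor(\delta-1)/2\rfloor,t}(G)$. -/
open Finset

/-- If `δ(G) ≥ 3`, then `γ_st(G) ≤ n - 2 L_{⌊(δ-1)/2⌋, t}(G)`. -/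
theorem signedTotalDominationNumber_le_of_totalLimitedPacking {V : Type*} [Fintype V]
    [DecidableEq V] (G : SimpleGraph V) [DecidableRel G.Adj] (hδ : 3 ≤ G.minDegree) :
    G.signedTotalDominationNumber ≤
      (Fintype.card V : ℤ) -
        2 * ((G.totalLimitedPackingNumber ((G.minDegree - 1) / 2) : ℤ)) := by
  have key : ∀ (s L : Finset V), ∑ u ∈ s, (if u ∈ L then (-1 : ℤ) else 1)
      = (s.card : ℤ) - 2 * ((s ∩ L).card : ℤ) := by
    intro s L
    have h1 : ∀ u ∈ s, (if u ∈ L then (-1 : ℤ) else 1) = 1 - 2 * (if u ∈ L then 1 else 0) := by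
      intro u _
      split_ifs <;> norm_num
    rw [Finset.sum_congr rfl h1, Finset.sum_sub_distrib, ← Finset.mul_sum, Finset.sum_boole,
      Finset.filter_mem_eq_inter]
    simp
  have hmem : G.totalLimitedPackingNumber ((G.minDegree - 1) / 2) ∈
      {m : ℕ | ∃ L : Finset V, G.IsTotalLimitedPacking ((G.minDegree - 1) / 2) L ∧ L.card = m} := by
    apply Nat.sSup_mem
    · exact ⟨0, ∅, by intro v; simp, by simp⟩
    · refine ⟨Fintype.card V, ?_⟩
      rintro m ⟨L, _, rfl⟩
      exact Finset.card_le_univ L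
  obtain ⟨L, hL, hc⟩ := hmem
  rw [← hc]
  apply csInf_le
  · refine ⟨-(Fintype.card V : ℤ), ?_⟩
    rintro w ⟨f, hf, rfl⟩
    have : ∑ _v : V, (-1 : ℤ) ≤ ∑ v, f v := by
      apply Finset.sum_le_sum
      intro v _
      rcases hf.1 v with h | h <;> rw [h]
      norm_num
    simpa using this
  · refine ⟨fun u => if u ∈ L then -1 else 1, ⟨?_, ?_⟩, ?_⟩
    · intro v
      by_cases h : v ∈ L <;> simp [h]
    · intro v
      rw [key, G.card_neighborFinset_eq_degree]
      have h1 := hL v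
      have h2 := G.minDegree_le_degree v
      omega
    · rw [key]
      simp
end

section
/- Let $G$ be a graph with minimum degree $\delta(G)\geq 3$. Then $L_{\lfloor(\delta-1)/2\rfloor,t}(G)\geq \lfloor(\delta-1)/2\rfloor-1+\rho_{o}(G)$. -/
open Finset

/-- If `δ(G) ≥ 3`, then `L_{⌊(δ-1)/2⌋, t}(G) ≥ ⌊(δ-1)/2⌋ - 1 + ρ_o(G)`. -/
theorem totalLimitedPackingNumber_ge {V : Type*} [Fintype V] [DecidableEq V]
    (G : SimpleGraph V) [DecidableRel G.Adj] (hδ : 3 ≤ G.minDegree) :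
    (G.minDegree - 1) / 2 - 1 + G.openPackingNumber ≤
      G.totalLimitedPackingNumber ((G.minDegree - 1) / 2) := by
  have hne : Nonempty V := by
    by_contra h
    rw [not_nonempty_iff] at h
    simp [SimpleGraph.minDegree] at hδ
  obtain ⟨v₀⟩ := hne
  have hbddB : BddAbove {m : ℕ | ∃ B : Finset V, G.IsOpenPacking B ∧ B.card = m} :=
    ⟨Fintype.card V, by rintro m ⟨B, -, rfl⟩; exact Finset.card_le_univ B⟩
  have hbddL : BddAbove {m : ℕ | ∃ L : Finset V,
      G.IsTotalLimitedPacking ((G.minDegree - 1) / 2) L ∧ L.card = m} :=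
    ⟨Fintype.card V, by rintro m ⟨B, -, rfl⟩; exact Finset.card_le_univ B⟩
  obtain ⟨B, hB, hBc⟩ : G.openPackingNumber ∈
      {m : ℕ | ∃ B : Finset V, G.IsOpenPacking B ∧ B.card = m} :=
    Nat.sSup_mem ⟨0, ∅, by simp [SimpleGraph.IsOpenPacking], rfl⟩ hbddB
  have h1 : ∀ v : V, (G.neighborFinset v ∩ B).card ≤ 1 := by
    intro v
    rw [Finset.card_le_one]
    intro a ha b hb
    by_contra hab
    simp only [Finset.mem_inter, SimpleGraph.mem_neighborFinset] at ha hb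
    have h := hB a ha.2 b hb.2 hab
    have hv : v ∈ G.neighborFinset a ∩ G.neighborFinset b := by
      simp [ha.1.symm, hb.1.symm]
    rw [h] at hv
    simp at hv
  have h2 : (G.minDegree - 1) / 2 - 1 ≤ (G.neighborFinset v₀ \ B).card := by
    have h3 := Finset.card_sdiff_add_card_inter (G.neighborFinset v₀) B
    have h4 := h1 v₀
    have h5 := G.minDegree_le_degree v₀
    rw [← SimpleGraph.card_neighborFinset_eq_degree] at h5
    omega
  obtain ⟨S, hS, hSc⟩ := Finset.exists_subset_card_eq h2
  have hd : Disjoint S B := Finset.disjoint_of_subset_left hS Finset.sdiff_disjoint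
  refine le_csSup hbddL ⟨S ∪ B, ?_, ?_⟩
  · intro v
    rw [Finset.inter_union_distrib_left]
    have h3 := Finset.card_union_le (G.neighborFinset v ∩ S) (G.neighborFinset v ∩ B)
    have h4 := h1 v
    have h5 : (G.neighborFinset v ∩ S).card ≤ S.card :=
      Finset.card_le_card Finset.inter_subset_right
    omega
  · rw [Finset.card_union_of_disjoint hd, hSc, hBc]
end

section
/- Let $G$ be a graph with maximum degree $\Delta(G)$ and let $k$ be a positive integer with $k<\Delta(G)$. Then $L_{k+1,t}(G)\geq L_{k,t}(G)+1$. -/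
open Finset

/-- If `1 ≤ k < Δ(G)`, then `L_{k+1,t}(G) ≥ L_{k,t}(G) + 1`. -/
theorem totalLimitedPackingNumber_succ {V : Type*} [Fintype V] [DecidableEq V]
    (G : SimpleGraph V) [DecidableRel G.Adj] (k : ℕ) (hk : 1 ≤ k) (hkΔ : k < G.maxDegree) :
    G.totalLimitedPackingNumber k + 1 ≤ G.totalLimitedPackingNumber (k + 1) := by
  have bdd : ∀ j, BddAbove {m : ℕ | ∃ L : Finset V, G.IsTotalLimitedPacking j L ∧ L.card = m} := by
    intro j
    refine ⟨Fintype.card V, ?_⟩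
    rintro m ⟨L, _, rfl⟩
    exact Finset.card_le_univ L
  have hmem := Nat.sSup_mem (s := {m : ℕ | ∃ L : Finset V, G.IsTotalLimitedPacking k L ∧ L.card = m})
    ⟨0, ∅, by intro v; simp, by simp⟩ (bdd k)
  obtain ⟨L, hL, hc⟩ := hmem
  have hx : ∃ x, x ∉ L := by
    by_contra! h
    have : G.maxDegree ≤ k := by
      apply G.maxDegree_le_of_forall_degree_le
      intro v
      have h1 := hL v
      rw [Finset.eq_univ_of_forall h, Finset.inter_univ, G.card_neighborFinset_eq_degree] at h1
      exact h1
    omega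
  obtain ⟨x, hx⟩ := hx
  unfold SimpleGraph.totalLimitedPackingNumber
  rw [← hc]
  apply le_csSup (bdd (k + 1))
  refine ⟨insert x L, ?_, Finset.card_insert_of_notMem hx⟩
  intro v
  have h1 : G.neighborFinset v ∩ insert x L ⊆ insert x (G.neighborFinset v ∩ L) := by
    intro y
    simp only [Finset.mem_inter, Finset.mem_insert]
    tauto
  have h2 := Finset.card_le_card h1
  have h3 := Finset.card_insert_le x (G.neighborFinset v ∩ L)
  have h4 := hL v
  omega
end

section
/- Let $G$ be a cubic graph (every vertex has degree 3) of order $n$. Then $\gamma_{st}(G)=2\gamma_{\times 2,t}(G)-n$. -/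
open Finset

theorem sum_sign_aux {V : Type*} [DecidableEq V] (T S : Finset V) (f : V → ℤ)
    (h1 : ∀ v ∈ S, f v = 1) (h2 : ∀ v, v ∉ S → f v = -1) :
    ∑ v ∈ T, f v = 2 * ((T ∩ S).card : ℤ) - (T.card : ℤ) := by
  have h : ∀ v ∈ T, f v = 2 * (if v ∈ S then 1 else 0) - 1 := by
    intro v _
    by_cases hv : v ∈ S
    · simp [hv, h1 v hv]
    · simp [hv, h2 v hv]
  rw [Finset.sum_congr rfl h, Finset.sum_sub_distrib, ← Finset.mul_sum]
  simp [Finset.filter_mem_eq_inter]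

/-- For a cubic graph `G` of order `n`, `γ_st(G) = 2 γ_{×2,t}(G) - n`. -/
theorem signedTotalDominationNumber_cubic {V : Type*} [Fintype V] [DecidableEq V]
    (G : SimpleGraph V) [DecidableRel G.Adj] (hcubic : ∀ v : V, G.degree v = 3) :
    G.signedTotalDominationNumber =
      2 * (G.tupleTotalDominationNumber 2 : ℤ) - (Fintype.card V : ℤ) := by
  have hne : {m : ℕ | ∃ S : Finset V, G.IsTupleTotalDominatingSet 2 S ∧ S.card = m}.Nonempty := by
    refine ⟨_, Finset.univ, ?_, rfl⟩
    intro v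
    simp [hcubic v]
  obtain ⟨S, hS, hSc⟩ := Nat.sInf_mem hne
  change S.card = G.tupleTotalDominationNumber 2 at hSc
  unfold SimpleGraph.signedTotalDominationNumber
  apply IsLeast.csInf_eq
  constructor
  · refine ⟨fun v => if v ∈ S then 1 else -1, ⟨?_, ?_⟩, ?_⟩
    · intro v
      by_cases hv : v ∈ S <;> simp [hv]
    · intro v
      rw [sum_sign_aux _ S _ (fun v hv => by simp [hv]) (fun v hv => by simp [hv]),
        G.card_neighborFinset_eq_degree, hcubic v]
      have := hS v
      push_cast
      omega
    · rw [sum_sign_aux _ S _ (fun v hv => by simp [hv]) (fun v hv => by simp [hv]),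
        Finset.univ_inter, hSc, Finset.card_univ]
  · rintro w ⟨f, ⟨hf, hd⟩, rfl⟩
    have a1 : ∀ v ∈ Finset.univ.filter (fun v => f v = 1), f v = 1 := by simp
    have a2 : ∀ v, v ∉ Finset.univ.filter (fun v => f v = 1) → f v = -1 := by
      intro v hv
      exact (hf v).resolve_left (by simpa using hv)
    have hle : G.tupleTotalDominationNumber 2 ≤ (Finset.univ.filter (fun v => f v = 1)).card := by
      refine Nat.sInf_le ⟨_, ?_, rfl⟩
      intro v
      have := hd v
      rw [sum_sign_aux _ _ f a1 a2, G.card_neighborFinset_eq_degree, hcubic v] at this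
      push_cast at this
      omega
    rw [sum_sign_aux _ _ f a1 a2, Finset.univ_inter, Finset.card_univ]
    omega
end

section
/- Let $G$ be a graph with minimum degree $\delta\geq 1$ and maximum degree $\Delta$, let $f:V\to\{-1,1\}$ be a signed total dominating function of $G$, and set $V_{+}=\{v:f(v)=1\}$ and $V_{-}=\{v:f(v)=-1\}$. Then $(\lfloor\delta/2\rfloor+1)|V_{-}|\leq |[V_{+},V_{-}]|\leq (\lceil\Delta/2\rceil-1)|V_{+}|$, where $[V_{+},V_{-}]$ denotes the set of edges of $G$ with one endpoint in $V_{+}$ and the other in $V_{-}$. -/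
open Finset

theorem crossEdges_card_aux {V : Type*} [Fintype V] [DecidableEq V]
    (G : SimpleGraph V) [DecidableRel G.Adj] (A B : Finset V) (hAB : Disjoint A B) :
    (G.crossEdges A B).card = ((A ×ˢ B).filter fun x => G.Adj x.1 x.2).card := by
  symm
  apply Finset.card_bij (fun x _ => s(x.1, x.2))
  · rintro ⟨a, b⟩ h
    simp only [Finset.mem_filter, Finset.mem_product] at h
    simp only [SimpleGraph.crossEdges, Finset.mem_filter, SimpleGraph.mem_edgeFinset,
      SimpleGraph.mem_edgeSet]
    exact ⟨h.2, a, h.1.1, b, h.1.2, rfl⟩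
  · rintro ⟨a, b⟩ h ⟨c, d⟩ h' e
    simp only [Finset.mem_filter, Finset.mem_product] at h h'
    rcases Sym2.eq_iff.1 e with ⟨h1, h2⟩ | ⟨h1, h2⟩
    · simp only at h1 h2
      rw [h1, h2]
    · simp only at h1 h2
      subst h1
      exact absurd h'.1.2 (Finset.disjoint_left.1 hAB h.1.1)
  · intro e he
    simp only [SimpleGraph.crossEdges, Finset.mem_filter, SimpleGraph.mem_edgeFinset] at he
    obtain ⟨h, a, ha, b, hb, rfl⟩ := he
    refine ⟨(a, b), ?_, rfl⟩
    simp only [Finset.mem_filter, Finset.mem_product]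
    exact ⟨⟨ha, hb⟩, h⟩

/-- For an STDF `f` of `G` with `δ ≥ 1`,
`(⌊δ/2⌋ + 1)|V₋| ≤ |[V₊, V₋]| ≤ (⌈Δ/2⌉ - 1)|V₊|`.
(Here `⌊δ/2⌋ = δ/2` and `⌈Δ/2⌉ = (Δ+1)/2` as natural-number divisions.) -/
theorem crossEdges_bounds {V : Type*} [Fintype V] [DecidableEq V]
    (G : SimpleGraph V) [DecidableRel G.Adj] (hδ : 1 ≤ G.minDegree)
    (f : V → ℤ) (hf : G.IsSTDF f) (Vp Vm : Finset V)
    (hVp : Vp = Finset.univ.filter fun v => f v = 1)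
    (hVm : Vm = Finset.univ.filter fun v => f v = -1) :
    (G.minDegree / 2 + 1) * Vm.card ≤ (G.crossEdges Vp Vm).card ∧
      (G.crossEdges Vp Vm).card ≤ ((G.maxDegree + 1) / 2 - 1) * Vp.card := by
  have hdis : Disjoint Vp Vm := by
    rw [Finset.disjoint_left]
    intro a ha hb
    simp only [hVp, hVm, Finset.mem_filter] at ha hb
    omega
  have key : ∀ v, (Vp.filter fun u => G.Adj v u).card + (Vm.filter fun u => G.Adj v u).card
      = G.degree v ∧ (Vm.filter fun u => G.Adj v u).card + 1
        ≤ (Vp.filter fun u => G.Adj v u).card := by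
    intro v
    have e1 : (Vp.filter fun u => G.Adj v u) = (G.neighborFinset v).filter fun u => f u = 1 := by
      ext u; simp [hVp, and_comm]
    have e2 : (Vm.filter fun u => G.Adj v u)
        = (G.neighborFinset v).filter fun u => ¬ f u = 1 := by
      ext u
      have := hf.1 u
      simp only [hVm, Finset.mem_filter, Finset.mem_univ, true_and,
        SimpleGraph.mem_neighborFinset]
      constructor
      · rintro ⟨h, h'⟩; exact ⟨h', by omega⟩
      · rintro ⟨h, h'⟩; exact ⟨by omega, h⟩
    rw [e1, e2]
    refine ⟨by rw [Finset.card_filter_add_card_filter_not, SimpleGraph.card_neighborFinset_eq_degree], ?_⟩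
    have h := hf.2 v
    rw [← Finset.sum_filter_add_sum_filter_not _ (fun u => f u = 1)] at h
    rw [Finset.sum_congr rfl (g := fun _ => (1 : ℤ)) (fun u hu => (Finset.mem_filter.1 hu).2),
      Finset.sum_congr (s₁ := (G.neighborFinset v).filter fun u => ¬ f u = 1) rfl
        (g := fun _ => (-1 : ℤ))
        (fun u hu => (hf.1 u).resolve_left (Finset.mem_filter.1 hu).2)] at h
    simp only [Finset.sum_const, nsmul_eq_mul] at h
    omega
  rw [crossEdges_card_aux G Vp Vm hdis, Finset.card_filter]
  constructor
  · rw [Finset.sum_product_right, mul_comm, ← smul_eq_mul]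
    apply Finset.card_nsmul_le_sum
    intro v _
    rw [← Finset.card_filter]
    dsimp only
    have h := key v
    have := G.minDegree_le_degree v
    simp only [G.adj_comm v] at h
    omega
  · rw [Finset.sum_product, mul_comm, ← smul_eq_mul]
    apply Finset.sum_le_card_nsmul
    intro v _
    rw [← Finset.card_filter]
    dsimp only
    have h := key v
    have := G.degree_le_maxDegree v
    omega
end

section
/- Let $G$ be a graph with minimum degree $\delta\geq 1$, let $f:V\to\{-1,1\}$ be a signed total dominating function of $G$, and set $V_{+}=\{v:f(v)=1\}$, $V_{-}=\{v:f(v)=-1\}$, $E_{+}=E(G[V_{+}])$, $E_{-}=E(G[V_{-}])$, and let $V_{e}$ be the set of vertices of $G$ of even degree. Then $n+|V_{-}|+4|E_{-}|+|V_{e}|\leq 2|E_{+}|+|[V_{+},V_{-}]|$, where $n$ is the order of $G$ and $[V_{+},V_{-}]$ is the set of edges with one endpoint in $V_{+}$ and the other in $V_{-}$. -/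
open Finset

theorem aux_within {V : Type*} [Fintype V] [DecidableEq V]
    (G : SimpleGraph V) [DecidableRel G.Adj] (A : Finset V) :
    ∑ v ∈ A, (G.neighborFinset v ∩ A).card = 2 * (G.edgesWithin A).card := by
  classical
  let H : SimpleGraph V :=
    { Adj := fun u v => G.Adj u v ∧ u ∈ A ∧ v ∈ A
      symm := ⟨fun u v h => ⟨h.1.symm, h.2.2, h.2.1⟩⟩
      loopless := ⟨fun u h => G.loopless.irrefl u h.1⟩ }
  have h1 : H.edgeFinset = G.edgesWithin A := by
    ext e
    induction e using Sym2.ind with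
    | _ a b => simp [SimpleGraph.edgesWithin, H]
  rw [← h1, ← H.sum_degrees_eq_twice_card_edges]
  rw [← Finset.sum_subset (Finset.subset_univ A)]
  · refine Finset.sum_congr rfl fun v hv => ?_
    rw [← SimpleGraph.card_neighborFinset_eq_degree]
    congr 1
    ext w
    simp [H, hv]
  · intro v _ hv
    rw [← SimpleGraph.card_neighborFinset_eq_degree, Finset.card_eq_zero]
    ext w
    simp [H, hv]

theorem aux_cross {V : Type*} [Fintype V] [DecidableEq V]
    (G : SimpleGraph V) [DecidableRel G.Adj] (A B : Finset V) (hd : Disjoint A B) :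
    ∑ v ∈ A, (G.neighborFinset v ∩ B).card = (G.crossEdges A B).card := by
  rw [← Finset.card_sigma]
  refine Finset.card_bij (fun p _ => s(p.1, p.2)) ?_ ?_ ?_
  · rintro ⟨a, b⟩ h
    simp only [Finset.mem_sigma, Finset.mem_inter, SimpleGraph.mem_neighborFinset] at h
    simp only [SimpleGraph.crossEdges, Finset.mem_filter, SimpleGraph.mem_edgeFinset,
      SimpleGraph.mem_edgeSet]
    exact ⟨h.2.1, a, h.1, b, h.2.2, rfl⟩
  · rintro ⟨a, b⟩ h ⟨c, d⟩ h' he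
    simp only [Finset.mem_sigma, Finset.mem_inter, SimpleGraph.mem_neighborFinset] at h h'
    rcases Sym2.eq_iff.1 he with ⟨h1, h2⟩ | ⟨h1, h2⟩
    · simp only at h1 h2
      subst h1 h2
      rfl
    · simp only at h1 h2
      exact absurd h'.2.2 (h1 ▸ Finset.disjoint_left.1 hd h.1)
  · intro e he
    simp only [SimpleGraph.crossEdges, Finset.mem_filter, SimpleGraph.mem_edgeFinset] at he
    obtain ⟨h1, a, ha, b, hb, rfl⟩ := he
    refine ⟨⟨a, b⟩, ?_, rfl⟩
    simp only [Finset.mem_sigma, Finset.mem_inter, SimpleGraph.mem_neighborFinset]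
    exact ⟨ha, h1, hb⟩

theorem aux_comm {V : Type*} [Fintype V] [DecidableEq V]
    (G : SimpleGraph V) [DecidableRel G.Adj] (A B : Finset V) :
    G.crossEdges A B = G.crossEdges B A := by
  unfold SimpleGraph.crossEdges
  refine Finset.filter_congr fun e _ => ⟨?_, ?_⟩ <;>
  · rintro ⟨a, ha, b, hb, rfl⟩
    exact ⟨b, hb, a, ha, Sym2.eq_swap⟩

/-- For an STDF `f` of `G` with `δ ≥ 1`,
`n + |V₋| + 4|E₋| + |V_e| ≤ 2|E₊| + |[V₊, V₋]|`. -/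
theorem stdf_edge_count_inequality {V : Type*} [Fintype V] [DecidableEq V]
    (G : SimpleGraph V) [DecidableRel G.Adj] (hδ : 1 ≤ G.minDegree)
    (f : V → ℤ) (hf : G.IsSTDF f) (Vp Vm : Finset V)
    (hVp : Vp = Finset.univ.filter fun v => f v = 1)
    (hVm : Vm = Finset.univ.filter fun v => f v = -1) :
    Fintype.card V + Vm.card + 4 * (G.edgesWithin Vm).card +
        (Finset.univ.filter fun v => Even (G.degree v)).card ≤
      2 * (G.edgesWithin Vp).card + (G.crossEdges Vp Vm).card := by
  have hd : Disjoint Vp Vm := by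
    rw [Finset.disjoint_left]
    intro a h1 h2
    simp only [hVp, hVm, Finset.mem_filter] at h1 h2
    omega
  have hc : Vmᶜ = Vp := by
    ext v
    have := hf.1 v
    simp only [hVp, hVm, Finset.mem_compl, Finset.mem_filter, Finset.mem_univ, true_and]
    omega
  have key : ∀ v, (G.neighborFinset v ∩ Vm).card + 1 + (if Even (G.degree v) then 1 else 0)
      ≤ (G.neighborFinset v ∩ Vp).card := by
    intro v
    have e1 : (G.neighborFinset v ∩ Vm).card + (G.neighborFinset v ∩ Vp).card = G.degree v := by
      rw [← hc, ← Finset.sdiff_eq_inter_compl, Finset.card_inter_add_card_sdiff,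
        SimpleGraph.card_neighborFinset_eq_degree]
    have e2 : ∑ u ∈ G.neighborFinset v, f u =
        (G.neighborFinset v ∩ Vp).card - (G.neighborFinset v ∩ Vm).card := by
      have : ∀ u, f u = (if u ∈ Vp then 1 else 0) - (if u ∈ Vm then 1 else 0) := by
        intro u
        rcases hf.1 u with h | h <;> simp [hVp, hVm, h]
      rw [Finset.sum_congr rfl fun u _ => this u]
      simp [Finset.sum_sub_distrib, Finset.sum_boole, Finset.filter_mem_eq_inter]
    have e3 := hf.2 v
    rw [e2] at e3
    split_ifs with hev
    · obtain ⟨k, hk⟩ := hev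
      omega
    · omega
  have w1 := aux_within G Vp
  have w2 := aux_within G Vm
  have c1 := aux_cross G Vp Vm hd
  have c2 := aux_cross G Vm Vp hd.symm
  rw [aux_comm G Vm Vp] at c2
  have s1 := Finset.sum_le_sum fun v (_ : v ∈ Finset.univ) => key v
  have s2 : ∑ v ∈ Vm, ((G.neighborFinset v ∩ Vm).card + 1) ≤
      ∑ v ∈ Vm, (G.neighborFinset v ∩ Vp).card :=
    Finset.sum_le_sum fun v _ => by have := key v; omega
  have t1 := Finset.sum_add_sum_compl Vm fun v => (G.neighborFinset v ∩ Vp).card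
  have t2 := Finset.sum_add_sum_compl Vm fun v => (G.neighborFinset v ∩ Vm).card
  rw [hc] at t1 t2
  rw [Finset.sum_add_distrib, Finset.sum_add_distrib, ← Finset.card_filter, Finset.sum_const,
    smul_eq_mul, mul_one, Finset.card_univ] at s1
  rw [Finset.sum_add_distrib, Finset.sum_const, smul_eq_mul, mul_one] at s2
  omega
end

section
/- Let $G$ be a graph of order $n$ with minimum degree $\delta\geq 1$ and maximum degree $\Delta$. Then $\gamma_{st}(G)\geq \dfrac{(\lfloor\delta/2\rfloor-\lceil\Delta/2\rceil+2)\,n}{\lfloor\delta/2\rfloor+\lceil\Delta/2\rceil}$. -/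
open Finset

theorem stdf_aux {V : Type*} [Fintype V] [DecidableEq V]
    (G : SimpleGraph V) [DecidableRel G.Adj] (hδ : 1 ≤ G.minDegree) (f : V → ℤ)
    (hf : G.IsSTDF f) :
    (((G.minDegree / 2 : ℕ) : ℤ) - (((G.maxDegree + 1) / 2 : ℕ) : ℤ) + 2) *
        (Fintype.card V : ℤ) ≤
    (∑ v, f v) * (((G.minDegree / 2 : ℕ) : ℤ) + (((G.maxDegree + 1) / 2 : ℕ) : ℤ)) := by
  obtain ⟨h1, h2⟩ := hf
  have key : ∀ s : Finset V, (∑ v ∈ s, f v = ((s.filter (fun v => f v = 1)).card : ℤ)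
      - ((s.filter (fun v => ¬ f v = 1)).card : ℤ)) := by
    intro s
    rw [← Finset.sum_filter_add_sum_filter_not s (fun v => f v = 1)]
    rw [Finset.sum_congr rfl (g := fun _ => (1 : ℤ)) (fun x hx => (Finset.mem_filter.1 hx).2),
      Finset.sum_congr (s₁ := s.filter (fun v => ¬ f v = 1)) rfl (g := fun _ => (-1 : ℤ))
        (fun x hx => (h1 x).resolve_left (Finset.mem_filter.1 hx).2)]
    simp
    ring
  have hc : ∀ s : Finset V, (s.filter (fun v => f v = 1)).card
      + (s.filter (fun v => ¬ f v = 1)).card = s.card := fun s =>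
    Finset.card_filter_add_card_filter_not _
  have hpos : ∀ v, G.minDegree / 2 + 1 ≤ ((G.neighborFinset v).filter (fun v => f v = 1)).card := by
    intro v
    have a := h2 v
    rw [key] at a
    have b := hc (G.neighborFinset v)
    have c := G.minDegree_le_degree v
    rw [G.card_neighborFinset_eq_degree] at b
    omega
  have hneg : ∀ v, ((G.neighborFinset v).filter (fun v => ¬ f v = 1)).card
      ≤ (G.maxDegree + 1) / 2 - 1 := by
    intro v
    have a := h2 v
    rw [key] at a
    have b := hc (G.neighborFinset v)
    have c := G.degree_le_maxDegree v
    rw [G.card_neighborFinset_eq_degree] at b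
    omega
  set P := univ.filter (fun v => f v = 1) with hP
  set M := univ.filter (fun v => ¬ f v = 1) with hM
  have dc := Finset.sum_card_bipartiteAbove_eq_sum_card_bipartiteBelow (s := M) (t := P) G.Adj
  have l : M.card * (G.minDegree / 2 + 1) ≤ ∑ a ∈ M, (P.bipartiteAbove G.Adj a).card := by
    rw [← smul_eq_mul]
    refine Finset.card_nsmul_le_sum _ _ _ fun v _ => (hpos v).trans (Finset.card_le_card ?_)
    intro x hx
    simp [Finset.bipartiteAbove, hP] at hx ⊢
    tauto
  have r : ∑ a ∈ P, (M.bipartiteBelow G.Adj a).card ≤ P.card * ((G.maxDegree + 1) / 2 - 1) := by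
    rw [← smul_eq_mul]
    refine Finset.sum_le_card_nsmul _ _ _ fun v _ => le_trans (Finset.card_le_card ?_) (hneg v)
    intro x hx
    simp [Finset.bipartiteBelow, hM] at hx ⊢
    exact ⟨hx.2.symm, hx.1⟩
  have e : M.card * (G.minDegree / 2 + 1) ≤ P.card * ((G.maxDegree + 1) / 2 - 1) := by
    rw [dc] at l; exact l.trans r
  have n : P.card + M.card = Fintype.card V := hc univ
  rw [key univ, ← n]
  by_cases hV : Nonempty V
  · obtain ⟨v⟩ := hV
    have d1 := G.minDegree_le_degree v
    have d2 := G.degree_le_maxDegree v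
    have : 1 ≤ (G.maxDegree + 1) / 2 := by omega
    generalize (G.maxDegree + 1) / 2 = b at *
    generalize G.minDegree / 2 = a at *
    zify [this] at e
    push_cast
    change _ ≤ ((P.card : ℤ) - M.card) * _
    nlinarith
  · have := not_nonempty_iff.1 hV
    simp [hP, hM]

/-- If `δ(G) ≥ 1`, then
`γ_st(G) ≥ (⌊δ/2⌋ - ⌈Δ/2⌉ + 2) n / (⌊δ/2⌋ + ⌈Δ/2⌉)`.
(Here `⌊δ/2⌋ = δ/2` and `⌈Δ/2⌉ = (Δ+1)/2` as natural-number divisions.) -/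
theorem signedTotalDominationNumber_lower_bound_i {V : Type*} [Fintype V] [DecidableEq V]
    (G : SimpleGraph V) [DecidableRel G.Adj] (hδ : 1 ≤ G.minDegree) :
    (((G.minDegree / 2 : ℕ) : ℚ) - (((G.maxDegree + 1) / 2 : ℕ) : ℚ) + 2) *
        (Fintype.card V : ℚ) /
        (((G.minDegree / 2 : ℕ) : ℚ) + (((G.maxDegree + 1) / 2 : ℕ) : ℚ)) ≤
      (G.signedTotalDominationNumber : ℚ) := by
  have hmem : G.signedTotalDominationNumber ∈
      {w : ℤ | ∃ f : V → ℤ, G.IsSTDF f ∧ w = ∑ v, f v} := by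
    apply Int.csInf_mem
    · refine ⟨_, fun _ => 1, ⟨fun _ => Or.inl rfl, fun v => ?_⟩, rfl⟩
      have c := G.minDegree_le_degree v
      simp
      omega
    · refine ⟨∑ _v : V, (-1), ?_⟩
      rintro w ⟨f, hf, rfl⟩
      refine Finset.sum_le_sum fun v _ => ?_
      rcases hf.1 v with h | h <;> omega
  obtain ⟨f, hf, hw⟩ := hmem
  have h := stdf_aux G hδ f hf
  rw [← hw] at h
  have hV : Nonempty V := by
    by_contra hV
    have := not_nonempty_iff.1 hV
    simp at hδ
  obtain ⟨v⟩ := hV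
  have d1 := G.minDegree_le_degree v
  have d2 := G.degree_le_maxDegree v
  have : 0 < G.minDegree / 2 + (G.maxDegree + 1) / 2 := by omega
  rw [div_le_iff₀ (by exact_mod_cast this)]
  generalize (G.maxDegree + 1) / 2 = b at *
  generalize G.minDegree / 2 = a at *
  have h' := (Int.cast_le (R := ℚ)).2 h
  simpa only [Int.cast_mul, Int.cast_add, Int.cast_sub, Int.cast_natCast, Int.cast_ofNat] using h'
end

section
/- Let $G$ be a graph of order $n$ and size $m$, with minimum degree $\delta\geq 1$ and maximum degree $\Delta$, and let $n_{e}$ be the number of vertices of $G$ of even degree. Then $\gamma_{st}(G)\geq \dfrac{(5-3\Delta-2\lceil\Delta/2\rceil)n+2n_{e}+8m}{3\Delta+2\lceil\Delta/2\rceil-1}$. -/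
open Finset

open Finset in
theorem stdf_key {V : Type*} [Fintype V] [DecidableEq V]
    (G : SimpleGraph V) [DecidableRel G.Adj] (f : V → ℤ) (hf : G.IsSTDF f) :
    2 * (Fintype.card V : ℤ) + ((Finset.univ.filter fun v => Even (G.degree v)).card : ℤ)
      + 4 * (G.edgeFinset.card : ℤ) ≤
    ((Finset.univ.filter fun v => f v = 1).card : ℤ) *
      (3 * (G.maxDegree : ℤ) + 2 * (((G.maxDegree + 1) / 2 : ℕ) : ℤ) - 1) := by
  obtain ⟨h1, h2⟩ := hf
  set P := Finset.univ.filter fun v => f v = 1 with hP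
  set M := Finset.univ.filter fun v => ¬ f v = 1 with hM
  have hsplit : ∀ g : V → ℤ, ∑ v, g v = ∑ v ∈ P, g v + ∑ v ∈ M, g v := fun g =>
    (Finset.sum_filter_add_sum_filter_not univ (fun v => f v = 1) g).symm
  let a : V → ℤ := fun v => ∑ u ∈ P, if G.Adj v u then 1 else 0
  let b : V → ℤ := fun v => ∑ u ∈ M, if G.Adj v u then 1 else 0
  have hdeg : ∀ v, (G.degree v : ℤ) = ∑ u, if G.Adj v u then 1 else 0 := by
    intro v
    rw [← G.card_neighborFinset_eq_degree, G.neighborFinset_eq_filter]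
    simp
  have hab : ∀ v, (G.degree v : ℤ) = a v + b v := fun v => by rw [hdeg, hsplit]
  have hsum : ∀ v, ∑ u ∈ G.neighborFinset v, f u = a v - b v := by
    intro v
    rw [G.neighborFinset_eq_filter, Finset.sum_filter, hsplit, sub_eq_add_neg]
    simp only [a, b]
    rw [← Finset.sum_neg_distrib]
    congr 1
    · refine Finset.sum_congr rfl fun u hu => ?_
      simp only [hP, mem_filter, mem_univ, true_and] at hu
      simp [hu]
    · refine Finset.sum_congr rfl fun u hu => ?_
      simp only [hM, mem_filter, mem_univ, true_and] at hu
      have := (h1 u).resolve_left hu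
      split_ifs <;> simp [this]
  have hge : ∀ v, 1 ≤ a v - b v := fun v => hsum v ▸ h2 v
  have hev : ∀ v, (G.degree v : ℤ) + 1 + (if Even (G.degree v) then 1 else 0) ≤ 2 * a v := by
    intro v
    have e1 := hab v
    have e2 := hge v
    split_ifs with h
    · obtain ⟨k, hk⟩ := h
      omega
    · omega
  have hle : ∀ v, (G.degree v : ℤ) ≤ G.maxDegree := fun v => by
    exact_mod_cast G.degree_le_maxDegree v
  have hb : ∀ v, b v ≤ (((G.maxDegree + 1) / 2 : ℕ) : ℤ) - 1 := by
    intro v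
    have e1 := hab v
    have e2 := hge v
    have e3 := hle v
    push_cast
    omega
  have hm : ∑ v, (G.degree v : ℤ) = 2 * (G.edgeFinset.card : ℤ) := by
    exact_mod_cast G.sum_degrees_eq_twice_card_edges
  have hA : ∑ v, a v = ∑ u ∈ P, (G.degree u : ℤ) := by
    simp only [a]
    rw [Finset.sum_comm]
    refine Finset.sum_congr rfl fun u _ => ?_
    rw [hdeg]
    simp only [G.adj_comm]
  have hB : ∑ v ∈ M, a v = ∑ u ∈ P, b u := by
    simp only [a, b]
    rw [Finset.sum_comm]
    refine Finset.sum_congr rfl fun u _ => Finset.sum_congr rfl fun w _ => ?_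
    simp only [G.adj_comm]
  have s1 := Finset.sum_le_sum fun v (_ : v ∈ (univ : Finset V)) => hev v
  rw [Finset.sum_add_distrib, Finset.sum_add_distrib, ← Finset.mul_sum, hA, hm] at s1
  simp only [Finset.sum_boole, Finset.sum_const, Finset.card_univ, nsmul_eq_mul, mul_one] at s1
  have s2 := Finset.sum_le_card_nsmul P (fun v => (G.degree v : ℤ)) _ fun v _ => hle v
  have s3 := Finset.sum_le_card_nsmul P b _ fun v _ => hb v
  have s4 : ∑ v ∈ M, ((G.degree v : ℤ) + 1) ≤ ∑ v ∈ M, 2 * a v := by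
    refine Finset.sum_le_sum fun v _ => ?_
    have e1 := hab v
    have e2 := hge v
    omega
  rw [← Finset.mul_sum, hB, Finset.sum_add_distrib] at s4
  simp only [Finset.sum_const, nsmul_eq_mul, mul_one] at s2 s3 s4
  have hn := hsplit fun _ => 1
  simp only [Finset.sum_const, Finset.card_univ, nsmul_eq_mul, mul_one] at hn
  have hm' := hsplit fun v => (G.degree v : ℤ)
  rw [hm] at hm'
  linarith

/-- If `δ(G) ≥ 1`, then
`γ_st(G) ≥ ((5 - 3Δ - 2⌈Δ/2⌉) n + 2 n_e + 8 m) / (3Δ + 2⌈Δ/2⌉ - 1)`,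
where `m` is the number of edges and `n_e` the number of vertices of even degree.
(Here `⌈Δ/2⌉ = (Δ+1)/2` as natural-number division.) -/
theorem signedTotalDominationNumber_lower_bound_ii {V : Type*} [Fintype V] [DecidableEq V]
    (G : SimpleGraph V) [DecidableRel G.Adj] (hδ : 1 ≤ G.minDegree) :
    ((5 - 3 * (G.maxDegree : ℚ) - 2 * (((G.maxDegree + 1) / 2 : ℕ) : ℚ)) *
          (Fintype.card V : ℚ) +
        2 * ((Finset.univ.filter fun v => Even (G.degree v)).card : ℚ) +
        8 * (G.edgeFinset.card : ℚ)) /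
        (3 * (G.maxDegree : ℚ) + 2 * (((G.maxDegree + 1) / 2 : ℕ) : ℚ) - 1) ≤
      (G.signedTotalDominationNumber : ℚ) := by
  have hmem : G.signedTotalDominationNumber ∈
      {w : ℤ | ∃ f : V → ℤ, G.IsSTDF f ∧ w = ∑ v, f v} := by
    refine Int.csInf_mem ⟨_, fun _ => 1, ⟨fun _ => Or.inl rfl, fun v => ?_⟩, rfl⟩ ?_
    · have := G.minDegree_le_degree v
      simp only [Finset.sum_const, G.card_neighborFinset_eq_degree, nsmul_eq_mul, mul_one]
      exact_mod_cast hδ.trans this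
    · refine ⟨∑ _v : V, (-1), ?_⟩
      rintro w ⟨f, hf, rfl⟩
      refine Finset.sum_le_sum fun v _ => ?_
      rcases hf.1 v with h | h <;> omega
  obtain ⟨f, hf, hw⟩ := hmem
  have key := stdf_key G f hf
  have hΔ : 1 ≤ G.maxDegree := hδ.trans G.minDegree_le_maxDegree
  have hw2 : ∑ v, f v = 2 * ((Finset.univ.filter fun v => f v = 1).card : ℤ)
      - Fintype.card V := by
    have : ∀ v, f v = 2 * (if f v = 1 then 1 else 0) - 1 := by
      intro v
      rcases hf.1 v with h | h <;> simp [h]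
    rw [Finset.sum_congr rfl fun v _ => this v, Finset.sum_sub_distrib, ← Finset.mul_sum]
    simp
  rw [hw, hw2]
  have hΔ' : (1 : ℚ) ≤ G.maxDegree := by exact_mod_cast hΔ
  have hc : (0 : ℚ) ≤ (((G.maxDegree + 1) / 2 : ℕ) : ℚ) := Nat.cast_nonneg _
  rw [div_le_iff₀ (by linarith)]
  generalize (G.maxDegree + 1) / 2 = c at *
  have key' := (Int.cast_le (R := ℚ)).2 key
  push_cast at key' ⊢
  linarith
end

section
/- Let $G$ be a graph of order $n$ and size $m$, with minimum degree $\delta\geq 1$ and maximum degree $\Delta$, and let $n_{e}$ be the number of vertices of $G$ of even degree. Then $\gamma_{st}(G)\geq \dfrac{(5+3\delta-2\lceil\Delta/2\rceil)n+2n_{e}-4m}{3\delta+2\lceil\Delta/2\rceil-1}$. -/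
open Finset

theorem stdf_swap {V : Type*} [Fintype V] [DecidableEq V]
    (G : SimpleGraph V) [DecidableRel G.Adj] (a b : V → ℤ) :
    ∑ v, a v * ∑ u ∈ G.neighborFinset v, b u = ∑ u, b u * ∑ v ∈ G.neighborFinset u, a v := by
  simp only [Finset.mul_sum]
  rw [Finset.sum_comm' (t' := Finset.univ) (s' := fun u => G.neighborFinset u)]
  · exact Finset.sum_congr rfl fun u _ => Finset.sum_congr rfl fun v _ => mul_comm _ _
  · intro x y
    simp [G.adj_comm]

theorem stdf_parity {V : Type*} (s : Finset V) (f : V → ℤ)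
    (hf : ∀ v, f v = 1 ∨ f v = -1) : ∃ k : ℤ, (s.card : ℤ) - ∑ u ∈ s, f u = 2 * k := by
  classical
  have h : ∀ v, ∃ k : ℤ, 1 - f v = 2 * k := fun v => by
    rcases hf v with h | h
    · exact ⟨0, by rw [h]; norm_num⟩
    · exact ⟨1, by rw [h]; norm_num⟩
  choose k hk using h
  refine ⟨∑ u ∈ s, k u, ?_⟩
  rw [Finset.mul_sum, ← Finset.sum_congr rfl fun u _ => hk u]
  simp

theorem stdf_bound {V : Type*} [Fintype V] [DecidableEq V]
    (G : SimpleGraph V) [DecidableRel G.Adj] (hδ : 1 ≤ G.minDegree) (f : V → ℤ)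
    (hf : G.IsSTDF f) :
    (5 + 3 * (G.minDegree : ℤ) - 2 * (((G.maxDegree + 1) / 2 : ℕ) : ℤ)) * (Fintype.card V : ℤ) +
        2 * ((Finset.univ.filter fun v => Even (G.degree v)).card : ℤ) -
        4 * (G.edgeFinset.card : ℤ) ≤
      (∑ v, f v) * (3 * (G.minDegree : ℤ) + 2 * (((G.maxDegree + 1) / 2 : ℕ) : ℤ) - 1) := by
  obtain ⟨h1, h2⟩ := hf
  have hd : ∀ v, (G.minDegree : ℤ) ≤ G.degree v := fun v => by
    exact_mod_cast G.minDegree_le_degree v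
  have hD : ∀ v, (G.degree v : ℤ) ≤ G.maxDegree := fun v => by
    exact_mod_cast G.degree_le_maxDegree v
  have hpar : ∀ v, ∃ k : ℤ, (G.degree v : ℤ) - ∑ u ∈ G.neighborFinset v, f u = 2 * k :=
    fun v => by simpa using stdf_parity (G.neighborFinset v) f h1
  have hp : ∀ v, 0 ≤ 1 + f v := fun v => by rcases h1 v with h | h <;> rw [h] <;> norm_num
  have hm : ∀ v, 0 ≤ 1 - f v := fun v => by rcases h1 v with h | h <;> rw [h] <;> norm_num
  have hm2 : ∑ v, (G.degree v : ℤ) = 2 * (G.edgeFinset.card : ℤ) := by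
    exact_mod_cast G.sum_degrees_eq_twice_card_edges
  have hA : ∑ v, ∑ u ∈ G.neighborFinset v, f u = ∑ v, f v * (G.degree v : ℤ) := by
    have := stdf_swap G (fun _ => 1) f
    simpa using this
  have hB := stdf_swap G (fun v => 1 + f v) (fun v => 1 - f v)
  simp only [Finset.sum_add_distrib, Finset.sum_sub_distrib, Finset.sum_const,
    SimpleGraph.card_neighborFinset_eq_degree, nsmul_eq_mul, mul_one] at hB
  have hL : ∑ v, (1 + f v) * ((G.degree v : ℤ) - ∑ u ∈ G.neighborFinset v, f u) ≤
      ∑ v, (1 + f v) * (2 * (((G.maxDegree + 1) / 2 : ℕ) : ℤ) - 2) := by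
    refine Finset.sum_le_sum fun v _ => mul_le_mul_of_nonneg_left ?_ (hp v)
    obtain ⟨k, hk⟩ := hpar v
    have := hD v
    have := h2 v
    omega
  have hR : ∑ v, (1 - f v) * ((G.minDegree : ℤ) + 1) ≤
      ∑ v, (1 - f v) * ((G.degree v : ℤ) + ∑ u ∈ G.neighborFinset v, f u) := by
    refine Finset.sum_le_sum fun v _ => mul_le_mul_of_nonneg_left ?_ (hm v)
    have := hd v
    have := h2 v
    omega
  have hE : ∑ v, ((1 : ℤ) + if Even (G.degree v) then 1 else 0) ≤
      ∑ v, ∑ u ∈ G.neighborFinset v, f u := by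
    refine Finset.sum_le_sum fun v _ => ?_
    obtain ⟨k, hk⟩ := hpar v
    have := h2 v
    split_ifs with he
    · obtain ⟨r, hr⟩ := he
      omega
    · omega
  have hF : ∑ v, (1 - f v) * (G.minDegree : ℤ) ≤ ∑ v, (1 - f v) * (G.degree v : ℤ) :=
    Finset.sum_le_sum fun v _ => mul_le_mul_of_nonneg_left (hd v) (hm v)
  rw [Finset.sum_add_distrib, Finset.sum_boole] at hE
  rw [← Finset.sum_mul] at hL hR hF
  have hF' : ∑ v, (1 - f v) * (G.degree v : ℤ) =
      2 * (G.edgeFinset.card : ℤ) - ∑ v, f v * (G.degree v : ℤ) := by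
    rw [← hm2, ← Finset.sum_sub_distrib]
    exact Finset.sum_congr rfl fun v _ => by ring
  rw [hF'] at hF
  simp only [Finset.sum_add_distrib, Finset.sum_sub_distrib, Finset.sum_const,
    Finset.card_univ, nsmul_eq_mul, mul_one] at hL hR hF hE
  have hLR := hR.trans (hB.symm.le.trans hL)
  have hE' := hE.trans hA.le
  linarith

/-- If `δ(G) ≥ 1`, then
`γ_st(G) ≥ ((5 + 3δ - 2⌈Δ/2⌉) n + 2 n_e - 4 m) / (3δ + 2⌈Δ/2⌉ - 1)`,
where `m` is the number of edges and `n_e` the number of vertices of even degree.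
(Here `⌈Δ/2⌉ = (Δ+1)/2` as natural-number division.) -/
theorem signedTotalDominationNumber_lower_bound_iii {V : Type*} [Fintype V] [DecidableEq V]
    (G : SimpleGraph V) [DecidableRel G.Adj] (hδ : 1 ≤ G.minDegree) :
    ((5 + 3 * (G.minDegree : ℚ) - 2 * (((G.maxDegree + 1) / 2 : ℕ) : ℚ)) *
          (Fintype.card V : ℚ) +
        2 * ((Finset.univ.filter fun v => Even (G.degree v)).card : ℚ) -
        4 * (G.edgeFinset.card : ℚ)) /
        (3 * (G.minDegree : ℚ) + 2 * (((G.maxDegree + 1) / 2 : ℕ) : ℚ) - 1) ≤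
      (G.signedTotalDominationNumber : ℚ) := by
  have hne : {w : ℤ | ∃ f : V → ℤ, G.IsSTDF f ∧ w = ∑ v, f v}.Nonempty := by
    refine ⟨_, fun _ => 1, ⟨fun _ => Or.inl rfl, fun v => ?_⟩, rfl⟩
    have := G.minDegree_le_degree v
    simp only [Finset.sum_const, SimpleGraph.card_neighborFinset_eq_degree, nsmul_eq_mul, mul_one]
    omega
  have hbdd : BddBelow {w : ℤ | ∃ f : V → ℤ, G.IsSTDF f ∧ w = ∑ v, f v} := by
    refine ⟨∑ _v : V, (-1 : ℤ), ?_⟩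
    rintro w ⟨f, hf, rfl⟩
    refine Finset.sum_le_sum fun v _ => ?_
    rcases hf.1 v with h | h <;> rw [h] <;> norm_num
  obtain ⟨f, hf, hw⟩ := Int.csInf_mem hne hbdd
  have hb := stdf_bound G hδ f hf
  rw [← hw] at hb
  have hq : (1 : ℚ) ≤ (G.minDegree : ℚ) := by exact_mod_cast hδ
  have hc : (0 : ℚ) ≤ (((G.maxDegree + 1) / 2 : ℕ) : ℚ) := Nat.cast_nonneg _
  rw [div_le_iff₀ (by linarith)]
  unfold SimpleGraph.signedTotalDominationNumber
  exact_mod_cast hb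
end

section
/- Let $G$ be an $r$-regular graph of order $n$ with $r\geq 1$. If $r$ is even then $\gamma_{st}(G)\geq 2n/r$, and if $r$ is odd then $\gamma_{st}(G)\geq n/r$. -/
open Finset

/-- For an `r`-regular graph `G` of order `n` with `r ≥ 1`:
if `r` is even then `γ_st(G) ≥ 2n/r`, and if `r` is odd then `γ_st(G) ≥ n/r`. -/
theorem signedTotalDominationNumber_regular {V : Type*} [Fintype V] [DecidableEq V]
    (G : SimpleGraph V) [DecidableRel G.Adj] (r : ℕ) (hr : 1 ≤ r)
    (hreg : G.IsRegularOfDegree r) :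
    (Even r → 2 * (Fintype.card V : ℚ) / (r : ℚ) ≤ (G.signedTotalDominationNumber : ℚ)) ∧
      (Odd r → (Fintype.card V : ℚ) / (r : ℚ) ≤ (G.signedTotalDominationNumber : ℚ)) := by
  have key : ∀ k : ℤ, (∀ f : V → ℤ, G.IsSTDF f → ∀ v, k ≤ ∑ u ∈ G.neighborFinset v, f u) →
      k * (Fintype.card V : ℚ) / (r : ℚ) ≤ (G.signedTotalDominationNumber : ℚ) := by
    intro k hk
    have hne : {w : ℤ | ∃ f : V → ℤ, G.IsSTDF f ∧ w = ∑ v, f v}.Nonempty := by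
      refine ⟨_, fun _ => 1, ⟨fun _ => Or.inl rfl, fun v => ?_⟩, rfl⟩
      have := hreg v
      simp only [Finset.sum_const, SimpleGraph.card_neighborFinset_eq_degree, this]
      simpa using hr
    have hbdd : BddBelow {w : ℤ | ∃ f : V → ℤ, G.IsSTDF f ∧ w = ∑ v, f v} := by
      refine ⟨∑ _v : V, (-1), ?_⟩
      rintro w ⟨f, hf, rfl⟩
      refine Finset.sum_le_sum fun v _ => ?_
      rcases hf.1 v with h | h <;> omega
    obtain ⟨f, hf, hw⟩ := Int.csInf_mem hne hbdd
    have hw' : G.signedTotalDominationNumber = ∑ v, f v := hw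
    have h1 : ∑ v, ∑ u ∈ G.neighborFinset v, f u = r * ∑ v, f v := by
      have : ∑ v, ∑ u ∈ G.neighborFinset v, f u = ∑ u, ∑ v ∈ G.neighborFinset u, f u :=
        Finset.sum_comm' (by intro x y; simp [G.adj_comm])
      rw [this, Finset.mul_sum]
      refine Finset.sum_congr rfl fun u _ => ?_
      have := hreg u
      simp [this]
    have h2 : ∑ _v : V, k ≤ ∑ v, ∑ u ∈ G.neighborFinset v, f u :=
      Finset.sum_le_sum fun v _ => hk f hf v
    rw [h1, ← hw'] at h2
    simp only [Finset.sum_const, Finset.card_univ, nsmul_eq_mul] at h2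
    have hr' : (0 : ℚ) < r := by exact_mod_cast hr
    rw [div_le_iff₀ hr']
    have h3 : k * (Fintype.card V : ℤ) ≤ G.signedTotalDominationNumber * r := by linarith
    exact_mod_cast h3
  refine ⟨fun he => ?_, fun _ => ?_⟩
  · refine le_trans (le_of_eq (by norm_num)) (key 2 fun f hf v => ?_)
    have h1 := hf.2 v
    have h2 : Even (∑ u ∈ G.neighborFinset v, (f u + 1)) := by
      refine Finset.even_sum _ fun u _ => ?_
      rcases hf.1 u with h | h <;> rw [h] <;> decide
    have h3 := hreg v
    simp only [Finset.sum_add_distrib, Finset.sum_const,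
      SimpleGraph.card_neighborFinset_eq_degree, h3] at h2
    obtain ⟨a, ha⟩ := h2
    obtain ⟨b, hb⟩ := he
    simp only [nsmul_eq_mul, mul_one] at ha
    omega
  · exact le_trans (le_of_eq (by norm_num)) (key 1 fun f hf v => hf.2 v)
end

section
/- Let $G$ be a graph of order $n$ with minimum degree $\delta\geq 1$ and maximum degree $\Delta$, and let $f:V\to\{-1,1\}$ be a signed total dominating function of $G$. Then the set $V_{-}=\{v:f(v)=-1\}$ is a $\lfloor(\Delta-1)/2\rfloor$-total limited packing in $G$; in particular $(n-\gamma_{st}(G))/2\leq L_{\lfloor(\Delta-1)/2\rfloor,t}(G)$. -/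
open Finset

theorem aux_sum {V : Type*} (f : V → ℤ) (hf : ∀ v, f v = 1 ∨ f v = -1) (s : Finset V) :
    ∑ u ∈ s, f u = (s.card : ℤ) - 2 * ((s.filter fun v => f v = -1).card : ℤ) := by
  have h : ∀ u ∈ s, f u = 1 - 2 * (if f u = -1 then 1 else 0) := by
    intro u _
    rcases hf u with h | h <;> simp [h]
  rw [Finset.sum_congr rfl h, Finset.sum_sub_distrib, ← Finset.mul_sum]
  simp

theorem aux_packing {V : Type*} [Fintype V] [DecidableEq V]
    (G : SimpleGraph V) [DecidableRel G.Adj] (f : V → ℤ) (hf : G.IsSTDF f) :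
    G.IsTotalLimitedPacking ((G.maxDegree - 1) / 2)
        (Finset.univ.filter fun v => f v = -1) := by
  intro v
  have h1 := hf.2 v
  rw [aux_sum f hf.1, G.card_neighborFinset_eq_degree] at h1
  have h2 := G.degree_le_maxDegree v
  have h3 : G.neighborFinset v ∩ (Finset.univ.filter fun v => f v = -1)
      = (G.neighborFinset v).filter fun v => f v = -1 := by
    ext u; simp
  rw [h3]
  omega

/-- If `δ(G) ≥ 1` and `f` is an STDF of `G`, then `V₋` is a
`⌊(Δ-1)/2⌋`-total limited packing; in particular `(n - γ_st(G))/2 ≤ L_{⌊(Δ-1)/2⌋,t}(G)`. -/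
theorem neg_set_isTotalLimitedPacking {V : Type*} [Fintype V] [DecidableEq V]
    (G : SimpleGraph V) [DecidableRel G.Adj] (hδ : 1 ≤ G.minDegree)
    (f : V → ℤ) (hf : G.IsSTDF f) :
    G.IsTotalLimitedPacking ((G.maxDegree - 1) / 2)
        (Finset.univ.filter fun v => f v = -1) ∧
      ((Fintype.card V : ℚ) - (G.signedTotalDominationNumber : ℚ)) / 2 ≤
        (G.totalLimitedPackingNumber ((G.maxDegree - 1) / 2) : ℚ) := by
  refine ⟨aux_packing G f hf, ?_⟩
  have hmem : G.signedTotalDominationNumber ∈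
      {w : ℤ | ∃ f : V → ℤ, G.IsSTDF f ∧ w = ∑ v, f v} := by
    apply Int.csInf_mem
    · exact ⟨_, f, hf, rfl⟩
    · refine ⟨-(Fintype.card V : ℤ), ?_⟩
      rintro w ⟨g, hg, rfl⟩
      rw [aux_sum g hg.1]
      have := Finset.card_filter_le (Finset.univ : Finset V) (fun v => g v = -1)
      rw [Finset.card_univ] at *
      omega
  obtain ⟨g, hg, hw⟩ := hmem
  have hle : (Finset.univ.filter fun v => g v = -1).card ≤
      G.totalLimitedPackingNumber ((G.maxDegree - 1) / 2) := by
    apply le_csSup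
    · refine ⟨Fintype.card V, ?_⟩
      rintro m ⟨L, _, rfl⟩
      exact Finset.card_le_univ L
    · exact ⟨_, aux_packing G g hg, rfl⟩
  rw [hw, aux_sum g hg.1, Finset.card_univ]
  have hq : ((Finset.univ.filter fun v => g v = -1).card : ℚ) ≤
      (G.totalLimitedPackingNumber ((G.maxDegree - 1) / 2) : ℚ) := by exact_mod_cast hle
  push_cast
  linarith
end

section
/- Let $G$ be a graph with minimum degree $\delta(G)\geq k$ for an integer $k\geq 2$. Then $\gamma_{\times k,t}(G)\geq \gamma_{\times(k-1),t}(G)+1$. -/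
open Finset

/-- If `δ(G) ≥ k ≥ 2`, then `γ_{×k,t}(G) ≥ γ_{×(k-1),t}(G) + 1`. -/
theorem tupleTotalDominationNumber_pred {V : Type*} [Fintype V] [DecidableEq V]
    (G : SimpleGraph V) [DecidableRel G.Adj] (k : ℕ) (hk : 2 ≤ k)
    (hδ : k ≤ G.minDegree) :
    G.tupleTotalDominationNumber (k - 1) + 1 ≤ G.tupleTotalDominationNumber k := by
  classical
  have hV : Nonempty V := by
    by_contra h
    rw [not_nonempty_iff] at h
    have : G.minDegree = 0 := by simp [SimpleGraph.minDegree]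
    omega
  have hne : {m : ℕ | ∃ S : Finset V, G.IsTupleTotalDominatingSet k S ∧ S.card = m}.Nonempty := by
    refine ⟨_, Finset.univ, ?_, rfl⟩
    intro v
    rw [Finset.inter_univ, SimpleGraph.card_neighborFinset_eq_degree]
    exact hδ.trans (G.minDegree_le_degree v)
  obtain ⟨S, hS, hc⟩ := Nat.sInf_mem hne
  have hc' : S.card = G.tupleTotalDominationNumber k := hc
  rw [← hc']
  obtain ⟨v⟩ := hV
  have h1 := hS v
  obtain ⟨u, hu⟩ : (G.neighborFinset v ∩ S).Nonempty := by
    rw [← Finset.card_pos]; omega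
  have huS : u ∈ S := (Finset.mem_inter.mp hu).2
  have h2 : G.tupleTotalDominationNumber (k - 1) ≤ (S.erase u).card := by
    apply Nat.sInf_le
    refine ⟨S.erase u, ?_, rfl⟩
    intro w
    have h3 := hS w
    have h4 := Finset.pred_card_le_card_erase (s := G.neighborFinset w ∩ S) (a := u)
    rw [Finset.inter_erase]
    omega
  have h5 := Finset.card_erase_add_one huS
  omega
end

section
/- Let $r\geq 2$ be an integer, and let $G$ be a $K_{r+1}$-free graph of order $n$ with minimum degree $\delta(G)\geq 1$. If $c=\lceil(\delta(G)+1)/2\rceil$, then $\gamma_{st}(G)\geq \dfrac{r}{r-1}\left(-(c-1)+\sqrt{(c-1)^{2}+4\frac{r-1}{r}cn}\right)-n$. -/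
open Finset

theorem aux_turan {V : Type*} [Fintype V] [DecidableEq V]
    (G : SimpleGraph V) [DecidableRel G.Adj] (r : ℕ)
    (hfree : G.CliqueFree (r + 1)) (P : Finset V) :
    r * ∑ v ∈ P, #(G.neighborFinset v ∩ P) ≤ (r - 1) * #P ^ 2 := by
  classical
  have hf : (G.induce (P : Set V)).CliqueFree (r + 1) :=
    hfree.comap (SimpleGraph.Embedding.induce (G := G) (P : Set V)).isContained
  have h1 := hf.card_edgeFinset_le
  dsimp only at h1
  rw [← SimpleGraph.card_edgeFinset_turanGraph] at h1
  have h2 := SimpleGraph.mul_card_edgeFinset_turanGraph_le (n := #P) (r := r)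
  have h3 := (G.induce (P : Set V)).sum_degrees_eq_twice_card_edges
  have h4 : ∑ v : (P : Set V), (G.induce (P : Set V)).degree v
      = ∑ v ∈ P, #(G.neighborFinset v ∩ P) := by
    rw [← Finset.sum_coe_sort P]
    refine Finset.sum_congr rfl fun v _ => ?_
    rw [← SimpleGraph.card_neighborFinset_eq_degree,
      ← Finset.card_map (Function.Embedding.subtype _)]
    congr 1
    ext w
    simp [and_comm]
  have h5 : Fintype.card (P : Set V) = #P := by simp
  rw [h5] at h1
  rw [← h4, h3]
  calc _ = 2 * r * #(G.induce (P : Set V)).edgeFinset := by ring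
    _ ≤ 2 * r * _ := Nat.mul_le_mul_left _ h1
    _ ≤ _ := h2

theorem aux_main {V : Type*} [Fintype V] [DecidableEq V]
    (G : SimpleGraph V) [DecidableRel G.Adj] (c : ℕ)
    (hc : c = (G.minDegree + 1 + 1) / 2) (f : V → ℤ) (hf : G.IsSTDF f) :
    ∃ P : Finset V, ∑ v, f v = 2 * (#P : ℤ) - Fintype.card V ∧
      c * Fintype.card V + #P ≤ ∑ v ∈ P, #(G.neighborFinset v ∩ P) + c * #P := by
  obtain ⟨h1, h2⟩ := hf
  let P : Finset V := univ.filter (fun v => f v = 1)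
  have hs : ∀ S : Finset V, ∑ v ∈ S, f v = 2 * (#(S ∩ P) : ℤ) - #S := by
    intro S
    have : ∀ v ∈ S, f v = 2 * (if v ∈ P then 1 else 0) - 1 := by
      intro v _
      rcases h1 v with h | h <;> simp [P, h]
    rw [Finset.sum_congr rfl this, Finset.sum_sub_distrib, ← Finset.mul_sum]
    simp [Finset.sum_ite_mem]
  have hd : ∀ v, G.degree v + 1 ≤ 2 * #(G.neighborFinset v ∩ P) := by
    intro v
    have := h2 v
    rw [hs, SimpleGraph.card_neighborFinset_eq_degree] at this
    omega
  have hcd : ∀ v, c ≤ #(G.neighborFinset v ∩ P) := by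
    intro v
    have := hd v
    have := G.minDegree_le_degree v
    omega
  have hsplit : ∀ v, #(G.neighborFinset v ∩ P) + #(G.neighborFinset v ∩ Pᶜ) = G.degree v := by
    intro v
    rw [← SimpleGraph.card_neighborFinset_eq_degree, ← Finset.sdiff_eq_inter_compl]
    exact Finset.card_inter_add_card_sdiff _ _
  have e : ∑ v ∈ P, #(G.neighborFinset v ∩ Pᶜ) = ∑ v ∈ Pᶜ, #(G.neighborFinset v ∩ P) := by
    have := Finset.sum_card_bipartiteAbove_eq_sum_card_bipartiteBelow (s := P) (t := Pᶜ) G.Adj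
    convert! this using 3 with v hv v hv
    · ext w; simp [Finset.bipartiteAbove, and_comm]
    · ext w; simp [Finset.bipartiteBelow, and_comm, G.adj_comm]
  have e1 : ∑ v ∈ P, (#(G.neighborFinset v ∩ Pᶜ) + 1) ≤ ∑ v ∈ P, #(G.neighborFinset v ∩ P) := by
    refine Finset.sum_le_sum fun v _ => ?_
    have := hd v
    have := hsplit v
    omega
  have e2 : #Pᶜ * c ≤ ∑ v ∈ Pᶜ, #(G.neighborFinset v ∩ P) := by
    rw [← smul_eq_mul]
    exact Finset.card_nsmul_le_sum _ _ _ fun v _ => hcd v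
  have e3 : #P + #Pᶜ = Fintype.card V := Finset.card_add_card_compl P
  rw [Finset.sum_add_distrib, e] at e1
  simp only [Finset.sum_const, smul_eq_mul, mul_one] at e1
  refine ⟨P, ?_, ?_⟩
  · rw [hs]; simp
  · rw [← e3]
    nlinarith

/-- Let `r ≥ 2` and let `G` be a `K_{r+1}`-free graph of order `n` with
`δ(G) ≥ 1`. If `c = ⌈(δ(G)+1)/2⌉`, then
`γ_st(G) ≥ (r/(r-1)) (-(c-1) + √((c-1)² + 4((r-1)/r) c n)) - n`.
(Here `⌈(δ+1)/2⌉ = (δ+1+1)/2` as natural-number division.) -/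
theorem signedTotalDominationNumber_cliqueFree {V : Type*} [Fintype V] [DecidableEq V]
    (G : SimpleGraph V) [DecidableRel G.Adj] (r : ℕ) (hr : 2 ≤ r)
    (hfree : G.CliqueFree (r + 1)) (hδ : 1 ≤ G.minDegree) (c : ℕ)
    (hc : c = (G.minDegree + 1 + 1) / 2) :
    (r : ℝ) / ((r : ℝ) - 1) *
        (-((c : ℝ) - 1) + Real.sqrt (((c : ℝ) - 1) ^ 2 +
          4 * (((r : ℝ) - 1) / (r : ℝ)) * (c : ℝ) * (Fintype.card V : ℝ))) -
        (Fintype.card V : ℝ) ≤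
      (G.signedTotalDominationNumber : ℝ) := by
  have hδ' := hδ
  have hne : {w : ℤ | ∃ f : V → ℤ, G.IsSTDF f ∧ w = ∑ v, f v}.Nonempty := by
    refine ⟨_, fun _ => 1, ⟨fun _ => Or.inl rfl, fun v => ?_⟩, rfl⟩
    have := G.minDegree_le_degree v
    simp
    omega
  refine Int.ceil_le.mp (le_csInf hne ?_)
  rintro w ⟨f, hf, rfl⟩
  rw [Int.ceil_le]
  obtain ⟨P, hP, hQ⟩ := aux_main G c hc f hf
  have hT := aux_turan G r hfree P
  rw [hP]
  obtain ⟨k, rfl⟩ : ∃ k, r = k + 1 := ⟨r - 1, by omega⟩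
  push_cast
  have hk : (1 : ℝ) ≤ k := by exact_mod_cast (by omega : 1 ≤ k)
  have hc1 : (1 : ℝ) ≤ c := by exact_mod_cast (by omega : 1 ≤ c)
  rw [Nat.add_sub_cancel] at hT
  have hT' : ((k : ℝ) + 1) * (∑ v ∈ P, #(G.neighborFinset v ∩ P) : ℕ) ≤ k * (#P : ℝ) ^ 2 := by
    exact_mod_cast hT
  have hQ' : (c : ℝ) * Fintype.card V + #P ≤
      (∑ v ∈ P, #(G.neighborFinset v ∩ P) : ℕ) + c * #P := by
    exact_mod_cast hQ
  generalize ((∑ v ∈ P, #(G.neighborFinset v ∩ P) : ℕ) : ℝ) = S at hT' hQ'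
  have hp : (0 : ℝ) ≤ #P := Nat.cast_nonneg _
  generalize (#P : ℝ) = p at *
  generalize (Fintype.card V : ℝ) = n at *
  generalize (c : ℝ) = d at *
  generalize (k : ℝ) = x at *
  rw [add_sub_cancel_right]
  set a := x / (x + 1) with ha
  have ha0 : 0 < a := by positivity
  have hxa : (x + 1) / x = a⁻¹ := by rw [ha, inv_div]
  have hS : S ≤ a * p ^ 2 := by
    rw [ha, div_mul_eq_mul_div, le_div_iff₀ (by positivity)]
    linarith
  have hsq : √((d - 1) ^ 2 + 4 * a * d * n) ≤ 2 * a * p + (d - 1) := by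
    apply Real.sqrt_le_iff.mpr
    constructor
    · have : 0 ≤ a * p := by positivity
      linarith
    · have : 0 ≤ a * (a * p ^ 2 + (d - 1) * p - d * n) :=
        mul_nonneg ha0.le (by linarith)
      nlinarith
  rw [hxa]
  have : a⁻¹ * (-(d - 1) + √((d - 1) ^ 2 + 4 * a * d * n)) ≤ a⁻¹ * (2 * a * p) :=
    mul_le_mul_of_nonneg_left (by linarith) (by positivity)
  have h2 : a⁻¹ * (2 * a * p) = 2 * p := by field_simp
  linarith
end
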